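/- Let G_1 and G_2 be two finite simple connected graphs on the same vertex set V = {1,…,n}. The following are equivalent: (i) G_1 = G_2 (they have the same edge set); (ii) M_{G_1} f = M_{G_2} f for every function f : V → ℝ; (iii) M_{G_1} δ_k = M_{G_2} δ_k for every k ∈ V. -/

import Mathlib

open scoped Classical
open Finset

noncomputable section

variable {V : Type*} [Fintype V]

/-- metric ball of radius `r` centered at `v` in the graph `G` -/
def gBall (G : SimpleGraph V) (v : V) (r : ℕ) : Finset V :=
  Finset.univ.filter fun w => G.dist v w ≤ r

/-- Hardy–Littlewood maximal operator on the graph `G` -/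
def maxOp (G : SimpleGraph V) (f : V → ℝ) (v : V) : ℝ :=
  ⨆ k : Fin (Fintype.card V), (∑ w ∈ gBall G v k.1, |f w|) / ((gBall G v k.1).card : ℝ)

/-- ℓ^p (quasi)norm of a function on the vertices -/
def pNorm (p : ℝ) (f : V → ℝ) : ℝ := (∑ v, |f v| ^ p) ^ (1 / p)

/-- operator (quasi)norm of the maximal operator of `G` on ℓ^p -/
def opNorm (G : SimpleGraph V) (p : ℝ) : ℝ :=
  ⨆ f : {f : V → ℝ // f ≠ 0}, pNorm p (maxOp G f.1) / pNorm p f.1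

/-- weak ℓ^p norm -/
def wNorm (p : ℝ) (f : V → ℝ) : ℝ :=
  ⨆ t : {t : ℝ // 0 < t},
    t.1 * ((Finset.univ.filter fun v => t.1 < |f v|).card : ℝ) ^ (1 / p)

/-- weak-type operator norm of the maximal operator of `G` -/
def wOpNorm (G : SimpleGraph V) (p : ℝ) : ℝ :=
  ⨆ f : {f : V → ℝ // f ≠ 0}, wNorm p (maxOp G f.1) / pNorm p f.1

/-- maximal operator over all graphs on `V` isomorphic to `G` -/
def maxOpIso (G : SimpleGraph V) (f : V → ℝ) (j : V) : ℝ :=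
  ⨆ H : {H : SimpleGraph V // Nonempty (H ≃g G)}, maxOp H.1 f j

/-- operator norm of `maxOpIso` on ℓ^p -/
def opNormIso (G : SimpleGraph V) (p : ℝ) : ℝ :=
  ⨆ f : {f : V → ℝ // f ≠ 0}, pNorm p (maxOpIso G f.1) / pNorm p f.1

/-- Kronecker delta at `k` -/
def kdelta (k : V) : V → ℝ := fun j => if j = k then 1 else 0

/-- star graph on `Fin n` with center `0` -/
def starGraph (n : ℕ) : SimpleGraph (Fin n) :=
  SimpleGraph.fromRel fun i _ => i.1 = 0

/-- diameter of a graph -/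
def gDiam (G : SimpleGraph V) : ℕ :=
  Finset.univ.sup fun p : V × V => G.dist p.1 p.2

/-- dilation index of a graph -/
def dilIndex (G : SimpleGraph V) : ℝ :=
  ⨆ x : V, ⨆ r : {r : ℕ // r ≤ gDiam G},
    ((gBall G x (3 * r.1)).card : ℝ) / ((gBall G x r.1).card : ℝ)

/-- overlapping index of a graph -/
def overlapIndex (G : SimpleGraph V) : ℕ :=
  sInf { r : ℕ | ∀ J : Finset (V × ℕ), ∃ I ⊆ J,
    J.biUnion (fun j => gBall G j.1 j.2) = I.biUnion (fun i => gBall G i.1 i.2) ∧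
    ∀ v : V, (I.filter fun i => v ∈ gBall G i.1 i.2).card ≤ r }

theorem mem_gBall {G : SimpleGraph V} {v w : V} {r : ℕ} : w ∈ gBall G v r ↔ G.dist v w ≤ r := by
  simp [gBall]

theorem gBall_subset_gBall (G : SimpleGraph V) (v : V) {r s : ℕ} (h : r ≤ s) :
    gBall G v r ⊆ gBall G v s :=
  fun _ hw => mem_gBall.2 ((mem_gBall.1 hw).trans h)

theorem card_gBall_pos (G : SimpleGraph V) (v : V) (r : ℕ) : 0 < (gBall G v r).card :=
  Finset.card_pos.2 ⟨v, mem_gBall.2 (by simp)⟩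

theorem SimpleGraph.Connected.dist_lt_card {G : SimpleGraph V} (hG : G.Connected) (v w : V) :
    G.dist v w < Fintype.card V := by
  obtain ⟨p, hp, hl⟩ := hG.exists_path_of_dist v w
  exact hl ▸ hp.length_lt

theorem sum_abs_kdelta {W : Type*} (s : Finset W) (k : W) :
    ∑ w ∈ s, |kdelta k w| = if k ∈ s then 1 else 0 := by
  simp [kdelta, apply_ite abs]

theorem maxOp_kdelta {G : SimpleGraph V} (hG : G.Connected) (k v : V) :
    maxOp G (kdelta k) v = ((gBall G v (G.dist v k)).card : ℝ)⁻¹ := by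
  have hlt := hG.dist_lt_card v k
  have : Nonempty (Fin (Fintype.card V)) := ⟨⟨_, hlt⟩⟩
  simp only [maxOp, sum_abs_kdelta, mem_gBall]
  apply le_antisymm
  · refine ciSup_le fun r => ?_
    split_ifs with h
    · rw [one_div]
      exact inv_anti₀ (by exact_mod_cast card_gBall_pos G v _)
        (by exact_mod_cast Finset.card_le_card (gBall_subset_gBall G v h))
    · rw [zero_div]
      positivity
  · exact le_ciSup_of_le (Set.finite_range _).bddAbove ⟨_, hlt⟩ (by simp)

/-- The neighbours of `v` are the vertices `w ≠ v` minimising the size of the ball around `v`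
that just reaches `w`. -/
theorem SimpleGraph.Connected.adj_iff_forall_card_gBall_le {G : SimpleGraph V}
    (hG : G.Connected) (v w : V) :
    G.Adj v w ↔ v ≠ w ∧ ∀ u, v ≠ u →
      (gBall G v (G.dist v w)).card ≤ (gBall G v (G.dist v u)).card := by
  constructor
  · intro h
    refine ⟨h.ne, fun u hu => Finset.card_le_card (gBall_subset_gBall G v ?_)⟩
    rw [SimpleGraph.dist_eq_one_iff_adj.2 h]
    exact hG.pos_dist_of_ne hu
  · rintro ⟨hne, h⟩
    have : Nontrivial V := ⟨v, w, hne⟩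
    obtain ⟨u, hu⟩ := hG.preconnected.exists_adj_of_nontrivial v
    have hpos := hG.pos_dist_of_ne hne
    have hle := h u hu.ne
    rw [SimpleGraph.dist_eq_one_iff_adj.2 hu] at hle
    have heq := Finset.eq_of_subset_of_card_le (gBall_subset_gBall G v hpos) hle
    have hw : w ∈ gBall G v 1 := heq ▸ mem_gBall.2 le_rfl
    exact SimpleGraph.dist_eq_one_iff_adj.1 (le_antisymm (mem_gBall.1 hw) hpos)

theorem eq_of_maxOp_kdelta_eq {G₁ G₂ : SimpleGraph V} (h₁ : G₁.Connected) (h₂ : G₂.Connected)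
    (h : ∀ k, maxOp G₁ (kdelta k) = maxOp G₂ (kdelta k)) : G₁ = G₂ := by
  have hc (v k : V) :
      (gBall G₁ v (G₁.dist v k)).card = (gBall G₂ v (G₂.dist v k)).card := by
    have hk := congrFun (h k) v
    rw [maxOp_kdelta h₁, maxOp_kdelta h₂, inv_inj] at hk
    exact_mod_cast hk
  ext v w
  simp only [h₁.adj_iff_forall_card_gBall_le, h₂.adj_iff_forall_card_gBall_le, hc]

/-- the maximal operator completely determines the graph. -/
theorem stmt3 (n : ℕ) (G₁ G₂ : SimpleGraph (Fin n))
    (h₁ : G₁.Connected) (h₂ : G₂.Connected) :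
    (G₁ = G₂ ↔ ∀ f : Fin n → ℝ, maxOp G₁ f = maxOp G₂ f) ∧
    (G₁ = G₂ ↔ ∀ k : Fin n, maxOp G₁ (kdelta k) = maxOp G₂ (kdelta k)) :=
  ⟨⟨fun h _ => h ▸ rfl, fun h => eq_of_maxOp_kdelta_eq h₁ h₂ fun _ => h _⟩,
    ⟨fun h _ => h ▸ rfl, eq_of_maxOp_kdelta_eq h₁ h₂⟩⟩
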